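/- arXiv:2011.08233 — 5 statements merged into one kernel-verified Lean document; each statement's English description precedes it below -/
import Mathlib

section
/- Let A be a finite abelian group and let x be an element of the rational group algebra ℚ[A]. Suppose that for every cyclic group C and every group homomorphism f : A → C, the induced ℚ-algebra homomorphism ℚ[A] → ℚ[C] sends x to 0. Then x = 0. -/
/-- The characters of a finite abelian group, extended linearly, jointly detect elements of its
rational group algebra. -/
theorem MonoidAlgebra.eq_zero_of_forall_lift_eq_zero {A : Type*} [CommGroup A] [Finite A]
    (x : MonoidAlgebra ℚ A) (h : ∀ φ : A →* ℂ, MonoidAlgebra.lift ℚ ℂ A φ x = 0) : x = 0 := by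
  classical
  have := Fintype.ofFinite A
  let F : (Additive A → ℂ) →ₗ[ℂ] ℂ :=
    Fintype.linearCombination ℂ fun a : Additive A ↦ (x.coeff a.toMul : ℂ)
  have hF : F = 0 := (AddChar.complexBasis (Additive A)).ext fun ψ ↦ by
    have hψ := h (ψ.toMonoidHom.comp (MulEquiv.multiplicativeAdditive A).symm.toMonoidHom)
    rw [MonoidAlgebra.lift_apply, Finsupp.sum_fintype _ _ (by simp)] at hψ
    simp only [AddChar.complexBasis_apply, F, Fintype.linearCombination_apply,
      LinearMap.zero_apply, smul_eq_mul]
    rw [← hψ, ← Additive.ofMul.sum_comp]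
    exact Finset.sum_congr rfl fun a _ ↦ by rw [Algebra.smul_def, mul_comm]; rfl
  ext a
  simpa [F, Fintype.linearCombination_apply_single] using
    LinearMap.congr_fun hF (Pi.single (Additive.ofMul a) 1)

/-- If an element `x` of the rational group algebra of a finite abelian group `A` is sent
to `0` by the induced `ℚ`-algebra homomorphism `ℚ[A] → ℚ[C]` for every cyclic group `C` and
every group homomorphism `f : A → C`, then `x = 0`. -/
theorem stmt_0 (A : Type) [CommGroup A] [Fintype A] (x : MonoidAlgebra ℚ A)
    (h : ∀ (C : Type) [Group C] [IsCyclic C] (f : A →* C),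
      MonoidAlgebra.mapDomainAlgHom ℚ ℚ f x = 0) :
    x = 0 := by
  refine MonoidAlgebra.eq_zero_of_forall_lift_eq_zero x fun φ ↦ ?_
  let ι : φ.toHomUnits.range →* ℂ := (Units.coeHom ℂ).comp φ.toHomUnits.range.subtype
  have hφ : MonoidAlgebra.lift ℚ ℂ A φ = (MonoidAlgebra.lift ℚ ℂ _ ι).comp
      (MonoidAlgebra.mapDomainAlgHom ℚ ℚ φ.toHomUnits.rangeRestrict) := by
    ext a
    simp [ι]
  rw [hφ, AlgHom.comp_apply, h, map_zero]
end

section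
/- Let p be a prime. The degree-3 group cohomology H³((ℤ/p)³; ℤ) of the rank-3 elementary abelian p-group (ℤ/p)³ with trivial ℤ-coefficients is isomorphic, as an abelian group, to (ℤ/p)³ (i.e., it is an elementary abelian p-group of rank 3). -/
section ConnectingMap

open CategoryTheory

theorem Fin.contractNth_castSucc_snoc {α : Type*} (op : α → α → α) {n : ℕ} (j : Fin (n + 1))
    (g : Fin (n + 1) → α) (x : α) :
    Fin.contractNth j.castSucc op (Fin.snoc (α := fun _ ↦ α) g x) =
      Fin.snoc (α := fun _ ↦ α) (Fin.contractNth j op g)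
        (if j = Fin.last n then op (g (Fin.last n)) x else x) := by
  ext k
  refine Fin.lastCases ?_ (fun k ↦ ?_) k
  · simp only [Fin.snoc_last]
    split_ifs with hj
    · rw [Fin.contractNth_apply_of_eq _ _ _ _ (by simp [hj])]
      rw [Fin.snoc_castSucc, Fin.succ_last, Fin.snoc_last]
    · rw [Fin.contractNth_apply_of_gt _ _ _ _
        (by simpa using! Fin.val_lt_last hj)]
      simp
  · simp only [Fin.contractNth, Fin.snoc_castSucc, Fin.succ_castSucc, Fin.val_castSucc]

theorem Fin.contractNth_last_snoc {α : Type*} (op : α → α → α) {n : ℕ}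
    (g : Fin n → α) (x : α) :
    Fin.contractNth (Fin.last n) op (Fin.snoc (α := fun _ ↦ α) g x) = g := by
  ext k
  simp [Fin.contractNth]

namespace groupCohomology

section FiniteGroup

variable {G : Type} [Group G] {V : Type} [AddCommGroup V]

theorem d_trivial_apply {n : ℕ} (f : (Fin n → G) → V) (g : Fin (n + 1) → G) :
    (inhomogeneousCochains.d (Rep.trivial ℤ G V) n f : (Fin (n + 1) → G) → V) g =
      f (fun i ↦ g i.succ) +
        ∑ j : Fin (n + 1), (-1 : ℤ) ^ ((j : ℕ) + 1) • f (Fin.contractNth j (· * ·) g) :=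
  rfl

theorem d_trivial_comp {W : Type} [AddCommGroup W] (φ : V →+ W) {n : ℕ} (f : (Fin n → G) → V) :
    inhomogeneousCochains.d (Rep.trivial ℤ G W) n (fun g ↦ φ (f g)) =
      fun g ↦ φ ((inhomogeneousCochains.d (Rep.trivial ℤ G V) n f :
        (Fin (n + 1) → G) → V) g) := by
  ext g
  refine (d_trivial_apply _ g).trans ?_
  rw [d_trivial_apply, map_add, map_sum]
  simp only [map_zsmul]

theorem d_sum_snoc [Fintype G] {n : ℕ} (f : (Fin (n + 1) → G) → V)
    (hf : inhomogeneousCochains.d (Rep.trivial ℤ G V) (n + 1) f = 0) :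
    inhomogeneousCochains.d (Rep.trivial ℤ G V) n
      (fun g ↦ ∑ x, f (Fin.snoc (α := fun _ ↦ G) g x)) =
      ((-1) ^ (n + 1) * (Fintype.card G : ℤ)) • f := by
  ext g
  have h (x : G) : _ = (0 : V) :=
    (d_trivial_apply f (Fin.snoc (α := fun _ ↦ G) g x)).symm.trans (congrFun hf _)
  have tail (x : G) : (fun i : Fin (n + 1) ↦ (Fin.snoc g x : Fin (n + 2) → G) i.succ) =
      Fin.snoc (α := fun _ ↦ G) (fun i : Fin n ↦ g i.succ) x := by
    ext k
    refine Fin.lastCases ?_ (fun k ↦ ?_) k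
    · rw [Fin.succ_last, Fin.snoc_last, Fin.snoc_last]
    · rw [Fin.succ_castSucc, Fin.snoc_castSucc, Fin.snoc_castSucc]
  refine (d_trivial_apply _ g).trans ?_
  simp only [Fin.sum_univ_castSucc (n := n + 1), Fin.contractNth_castSucc_snoc,
    Fin.contractNth_last_snoc, tail, Fin.val_castSucc, Fin.val_last] at h
  have shift (j : Fin (n + 1)) :
      ∑ x, f (Fin.snoc (α := fun _ ↦ G) (Fin.contractNth j (· * ·) g)
        (if j = Fin.last n then g (Fin.last n) * x else x)) =
      ∑ x, f (Fin.snoc (α := fun _ ↦ G) (Fin.contractNth j (· * ·) g) x) := by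
    split_ifs
    · exact Equiv.sum_comp (Equiv.mulLeft (g (Fin.last n)))
        fun x ↦ f (Fin.snoc (α := fun _ ↦ G) (Fin.contractNth j (· * ·) g) x)
    · rfl
  have hsum := Finset.sum_congr (s₁ := Finset.univ) rfl fun x _ ↦ h x
  simp only [Finset.sum_add_distrib, Finset.sum_const_zero, Finset.sum_const,
    Finset.card_univ] at hsum
  rw [Finset.sum_comm] at hsum
  simp only [← Finset.smul_sum, shift] at hsum
  rw [← add_assoc] at hsum
  rw [eq_neg_of_add_eq_zero_left hsum, Pi.smul_apply, mul_smul, natCast_zsmul,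
    smul_comm, pow_succ _ (n + 1), mul_neg_one, neg_smul, neg_neg]

/-- The cohomology of a finite group with coefficients in a rational vector space with trivial
action vanishes in positive degrees. -/
theorem isZero_trivial_of_module_rat [Fintype G] [Module ℚ V] (n : ℕ) :
    Limits.IsZero (groupCohomology (Rep.trivial ℤ G V) (n + 1)) := by
  rw [groupCohomology, ← HomologicalComplex.exactAt_iff_isZero_homology,
    HomologicalComplex.exactAt_iff' _ n (n + 1) (n + 2) (by simp) (by simp),
    ShortComplex.moduleCat_exact_iff]
  intro (f : (Fin (n + 1) → G) → V) hf
  have hf' : inhomogeneousCochains.d (Rep.trivial ℤ G V) (n + 1) f = 0 := by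
    rw [← inhomogeneousCochains.d_def]; exact hf
  let c : ℤ := (-1) ^ (n + 1) * (Fintype.card G : ℤ)
  have hc : (c : ℚ) ≠ 0 := by simp [c]
  let φ : V →+ V := DistribSMul.toAddMonoidHom V (c : ℚ)⁻¹
  have hφ : inhomogeneousCochains.d (Rep.trivial ℤ G V) (n + 1)
      (fun g ↦ φ (f g)) = 0 := by
    rw [d_trivial_comp, hf']
    ext g
    exact map_zero φ
  refine ⟨fun g ↦ ∑ x, φ (f (Fin.snoc (α := fun _ ↦ G) g x)), ?_⟩
  have hd := d_sum_snoc _ hφ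
  refine (ConcreteCategory.congr_hom (inhomogeneousCochains.d_def (Rep.trivial ℤ G V) n) _).trans
    (hd.trans ?_)
  ext g
  change c • ((c : ℚ)⁻¹ • f g) = f g
  rw [← Int.cast_smul_eq_zsmul ℚ, smul_inv_smul₀ hc]

end FiniteGroup

/-- The exact sequence `0 ⟶ ℤ ⟶ ℝ ⟶ ℝ/ℤ ⟶ 0` of trivial representations. -/
noncomputable def intRealCircle (G : Type) [Group G] : ShortComplex (Rep ℤ G) where
  X₁ := Rep.trivial ℤ G ℤ
  X₂ := Rep.trivial ℤ G ℝ
  X₃ := Rep.trivial ℤ G UnitAddCircle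
  f := Rep.ofHom ⟨(Int.castAddHom ℝ).toIntLinearMap, fun _ ↦ rfl⟩
  g := Rep.ofHom
    ⟨(QuotientAddGroup.mk' (AddSubgroup.zmultiples (1 : ℝ)) :
      ℝ →+ UnitAddCircle).toIntLinearMap, fun _ ↦ rfl⟩
  zero := by
    refine Rep.hom_ext (DFunLike.ext _ _ fun x ↦ ?_)
    exact (AddCircle.coe_eq_zero_iff (1 : ℝ)).2 ⟨x, zsmul_one (x : ℤ)⟩

theorem shortExact_of_injective_of_surjective {k G : Type} [CommRing k] [Group G]
    {S : ShortComplex (Rep.{0} k G)} (hf : Function.Injective S.f.hom)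
    (hg : Function.Surjective S.g.hom) (h : ∀ x, S.g.hom x = 0 → ∃ y, S.f.hom y = x) :
    S.ShortExact where
  exact := (forget₂ (Rep k G) (ModuleCat k)).reflects_exact_of_faithful _ <|
    (ShortComplex.moduleCat_exact_iff _).2 h
  mono_f := (Rep.mono_iff_injective _).2 hf
  epi_g := (Rep.epi_iff_surjective _).2 hg

theorem intRealCircle_shortExact (G : Type) [Group G] : (intRealCircle G).ShortExact :=
  shortExact_of_injective_of_surjective (Int.cast_injective (α := ℝ))
    (QuotientAddGroup.mk_surjective (s := AddSubgroup.zmultiples (1 : ℝ))) fun (x : ℝ) hx ↦ by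
      obtain ⟨n, hn⟩ := (AddCircle.coe_eq_zero_iff (1 : ℝ)).1 hx
      exact ⟨n, (zsmul_one n).symm.trans hn⟩

/-- For a finite group, `H²(G, ℝ/ℤ) ≃ H³(G, ℤ)`. -/
noncomputable def H2CircleEquivH3Int (G : Type) [Group G] [Finite G] :
    groupCohomology (Rep.trivial ℤ G UnitAddCircle) 2 ≃+
      groupCohomology (Rep.trivial ℤ G ℤ) 3 :=
  haveI := Fintype.ofFinite G
  haveI := isIso_δ_of_isZero (intRealCircle_shortExact G) 2
    (isZero_trivial_of_module_rat 1) (isZero_trivial_of_module_rat 2)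
  (asIso (δ (intRealCircle_shortExact G) 2 3 rfl)).toLinearEquiv.toAddEquiv

end groupCohomology

end ConnectingMap

section BilinearCocycles

/-- The underlying type of the extension of `G` by `D` attached to a `2`-cocycle. -/
@[ext]
structure CocycleExtension (D G : Type*) where
  /-- The component in the kernel. -/
  fst : D
  /-- The component in the quotient. -/
  snd : G

section Extension

variable {G D : Type*} [CommGroup G] [AddCommGroup D] {f : G × G → D}

theorem cocycle_one_left
    (hf : ∀ g h j, f (g * h, j) + f (g, h) = f (h, j) + f (g, h * j)) (g : G) :
    f (1, g) = f (1, 1) := by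
  have := hf 1 1 g
  simp only [one_mul] at this
  exact (add_left_cancel this).symm

/-- The abelian group structure on the extension of `G` by `D` attached to a symmetric
`2`-cocycle. -/
@[reducible]
def CocycleExtension.addCommGroup
    (hf : ∀ g h j, f (g * h, j) + f (g, h) = f (h, j) + f (g, h * j))
    (hs : ∀ g h, f (g, h) = f (h, g)) : AddCommGroup (CocycleExtension D G) :=
  letI : Add (CocycleExtension D G) :=
    ⟨fun x y ↦ ⟨x.fst + y.fst + f (x.snd, y.snd), x.snd * y.snd⟩⟩
  letI : Zero (CocycleExtension D G) := ⟨⟨-f (1, 1), 1⟩⟩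
  letI : Neg (CocycleExtension D G) :=
    ⟨fun x ↦ ⟨-x.fst - f (x.snd⁻¹, x.snd) - f (1, 1), x.snd⁻¹⟩⟩
  { AddGroup.ofLeftAxioms
      (fun x y z : CocycleExtension D G ↦ CocycleExtension.ext
        (by
          change x.fst + y.fst + f (x.snd, y.snd) + z.fst + f (x.snd * y.snd, z.snd) =
            x.fst + (y.fst + z.fst + f (y.snd, z.snd)) + f (x.snd, y.snd * z.snd)
          have := hf x.snd y.snd z.snd
          grind)
        (mul_assoc _ _ _))
      (fun x ↦ CocycleExtension.ext
        (by
          change -f (1, 1) + x.fst + f (1, x.snd) = x.fst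
          rw [cocycle_one_left hf x.snd]
          abel)
        (one_mul _))
      (fun x ↦ CocycleExtension.ext
        (by
          change -x.fst - f (x.snd⁻¹, x.snd) - f (1, 1) + x.fst + f (x.snd⁻¹, x.snd) = -f (1, 1)
          abel)
        (inv_mul_cancel _)) with
    add_comm x y := CocycleExtension.ext
      (by
        change x.fst + y.fst + f (x.snd, y.snd) = y.fst + x.fst + f (y.snd, x.snd)
        rw [hs, add_comm x.fst])
      (mul_comm _ _) }

/-- Symmetric `2`-cocycles on an abelian group with values in a divisible group, with trivial
action, are coboundaries. -/
theorem exists_coboundary_of_symm [DivisibleBy D ℤ]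
    (hf : ∀ g h j, f (g * h, j) + f (g, h) = f (h, j) + f (g, h * j))
    (hs : ∀ g h, f (g, h) = f (h, g)) :
    ∃ u : G → D, ∀ g h, u h - u (g * h) + u g = f (g, h) := by
  let := CocycleExtension.addCommGroup hf hs
  have add_def (x y : CocycleExtension D G) :
      x + y = ⟨x.fst + y.fst + f (x.snd, y.snd), x.snd * y.snd⟩ := rfl
  let i : D →+ CocycleExtension D G := AddMonoidHom.mk' (fun a ↦ ⟨a - f (1, 1), 1⟩) fun a b ↦ by
    simp only [add_def, mul_one, CocycleExtension.mk.injEq, and_true]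
    abel
  have hi : Function.Injective i := fun a b h ↦
    sub_left_injective (congrArg CocycleExtension.fst h)
  obtain ⟨r, hr⟩ := (Module.Baer.of_divisible D).extension_property_addMonoidHom i hi
    (AddMonoidHom.id D)
  refine ⟨fun g ↦ r ⟨0, g⟩, fun g h ↦ ?_⟩
  have h₁ : (⟨0, g⟩ + ⟨0, h⟩ : CocycleExtension D G) = i (f (g, h)) + ⟨0, g * h⟩ := by
    simp only [add_def, i, AddMonoidHom.mk'_apply, one_mul, cocycle_one_left hf (g * h)]
    simp
  have h₂ : r (i (f (g, h))) = f (g, h) := DFunLike.congr_fun hr _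
  have h₃ := congrArg r h₁
  rw [map_add, map_add, h₂] at h₃
  grind

/-- The antisymmetrization of a `2`-cocycle on an abelian group is multiplicative in its
first variable. -/
theorem antisymm_cocycle_mul_left
    (hf : ∀ g h j, f (g * h, j) + f (g, h) = f (h, j) + f (g, h * j)) (g h j : G) :
    f (g * h, j) - f (j, g * h) = (f (g, j) - f (j, g)) + (f (h, j) - f (j, h)) := by
  have h₁ := hf g h j
  have h₂ := hf j g h
  have h₃ := hf g j h
  rw [mul_comm j g] at h₂
  rw [mul_comm j h] at h₃
  grind

end Extension

open groupCohomology

theorem ZMod.exists_toAddCircle_eq {n : ℕ} [NeZero n] {u : UnitAddCircle} (hu : n • u = 0) :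
    ∃ a : ZMod n, ZMod.toAddCircle a = u := by
  obtain ⟨m, -, hm⟩ := (AddCircle.nsmul_eq_zero_iff (NeZero.pos n)).1 hu
  exact ⟨m, by rw [ZMod.toAddCircle_natCast, ← hm, mul_one]⟩

theorem ZMod.prod_addMonoidHom_ext {n : ℕ} [NeZero n] {D : Type*} [AddCommGroup D]
    {φ ψ : ZMod n × ZMod n × ZMod n →+ D} (h₁ : φ (1, 0, 0) = ψ (1, 0, 0))
    (h₂ : φ (0, 1, 0) = ψ (0, 1, 0)) (h₃ : φ (0, 0, 1) = ψ (0, 0, 1)) : φ = ψ := by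
  ext x
  have hx : x = x.1.val • (1, 0, 0) + x.2.1.val • (0, 1, 0) + x.2.2.val • (0, 0, 1) := by
    ext <;> simp
  rw [hx]
  simp only [map_add, map_nsmul, h₁, h₂, h₃]

section ElementaryAbelian

variable {A D : Type*} [AddCommGroup A] [AddCommGroup D]
  {f : Multiplicative A × Multiplicative A → D}

/-- The antisymmetrization of a `2`-cocycle, as a homomorphism in the first variable. -/
def antisymmCocycle
    (hf : ∀ g h j, f (g * h, j) + f (g, h) = f (h, j) + f (g, h * j)) (j : A) : A →+ D :=
  AddMonoidHom.mk' (fun a ↦ f (.ofAdd a, .ofAdd j) - f (.ofAdd j, .ofAdd a))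
    fun _ _ ↦ antisymm_cocycle_mul_left hf _ _ _

theorem antisymmCocycle_swap
    (hf : ∀ g h j, f (g * h, j) + f (g, h) = f (h, j) + f (g, h * j)) (a b : A) :
    antisymmCocycle hf a b = -antisymmCocycle hf b a :=
  (neg_sub _ _).symm

theorem antisymmCocycle_self
    (hf : ∀ g h j, f (g * h, j) + f (g, h) = f (h, j) + f (g, h * j)) (a : A) :
    antisymmCocycle hf a a = 0 :=
  sub_self _

end ElementaryAbelian

section Rank3

variable {p : ℕ}

theorem antisymmCocycle_eq_zero [NeZero p] {D : Type*} [AddCommGroup D]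
    {f : Multiplicative (ZMod p × ZMod p × ZMod p) × Multiplicative (ZMod p × ZMod p × ZMod p) → D}
    (hf : ∀ g h j, f (g * h, j) + f (g, h) = f (h, j) + f (g, h * j))
    (h₁₂ : antisymmCocycle hf (0, 1, 0) (1, 0, 0) = 0)
    (h₁₃ : antisymmCocycle hf (0, 0, 1) (1, 0, 0) = 0)
    (h₂₃ : antisymmCocycle hf (0, 0, 1) (0, 1, 0) = 0) (a : ZMod p × ZMod p × ZMod p) :
    antisymmCocycle hf a = 0 := by
  have e₁ : antisymmCocycle hf (1, 0, 0) = 0 := ZMod.prod_addMonoidHom_ext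
    (antisymmCocycle_self hf _) (by simp [antisymmCocycle_swap hf (1, 0, 0), h₁₂])
    (by simp [antisymmCocycle_swap hf (1, 0, 0), h₁₃])
  have e₂ : antisymmCocycle hf (0, 1, 0) = 0 := ZMod.prod_addMonoidHom_ext
    h₁₂ (antisymmCocycle_self hf _) (by simp [antisymmCocycle_swap hf (0, 1, 0), h₂₃])
  have e₃ : antisymmCocycle hf (0, 0, 1) = 0 := ZMod.prod_addMonoidHom_ext
    h₁₃ h₂₃ (antisymmCocycle_self hf _)
  refine ZMod.prod_addMonoidHom_ext ?_ ?_ ?_ <;>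
    simp [antisymmCocycle_swap hf a, e₁, e₂, e₃]

/-- The bilinear `2`-cochain on `(ℤ/p)³` with values in `ℝ/ℤ` attached to the coefficients of a
strictly upper triangular matrix. -/
noncomputable def upperTriangularCochain [NeZero p] (t : ZMod p × ZMod p × ZMod p)
    (x : Multiplicative (ZMod p × ZMod p × ZMod p) × Multiplicative (ZMod p × ZMod p × ZMod p)) :
    UnitAddCircle :=
  ZMod.toAddCircle (t.1 * (x.1.toAdd.1 * x.2.toAdd.2.1) + t.2.1 * (x.1.toAdd.1 * x.2.toAdd.2.2) +
    t.2.2 * (x.1.toAdd.2.1 * x.2.toAdd.2.2))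

theorem upperTriangularCochain_add [NeZero p] (s t : ZMod p × ZMod p × ZMod p) :
    upperTriangularCochain (s + t) = upperTriangularCochain s + upperTriangularCochain t := by
  ext x
  simp only [upperTriangularCochain, Pi.add_apply, ← map_add]
  congr 1
  simp only [Prod.fst_add, Prod.snd_add]
  ring

theorem upperTriangularCochain_cocycle [NeZero p] (t : ZMod p × ZMod p × ZMod p)
    (g h j : Multiplicative (ZMod p × ZMod p × ZMod p)) :
    upperTriangularCochain t (g * h, j) + upperTriangularCochain t (g, h) =
      upperTriangularCochain t (h, j) + upperTriangularCochain t (g, h * j) := by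
  simp only [upperTriangularCochain, ← map_add]
  congr 1
  simp only [toAdd_mul, Prod.fst_add, Prod.snd_add]
  ring

/-- The classes of the bilinear cocycles `upperTriangularCochain`. -/
noncomputable def upperTriangularClass (p : ℕ) [NeZero p] : ZMod p × ZMod p × ZMod p →+
    groupCohomology (Rep.trivial ℤ (Multiplicative (ZMod p × ZMod p × ZMod p)) UnitAddCircle) 2 :=
  (H2π (Rep.trivial ℤ (Multiplicative (ZMod p × ZMod p × ZMod p))
      UnitAddCircle)).hom.toAddMonoidHom.comp <|
    AddMonoidHom.mk' (fun t ↦ ⟨upperTriangularCochain t,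
        (mem_cocycles₂_iff _).2 (upperTriangularCochain_cocycle t)⟩)
      fun s t ↦ Subtype.ext (upperTriangularCochain_add s t)

theorem mem_coboundaries₂_trivial_iff {G V : Type} [Group G] [AddCommGroup V] {f : G × G → V} :
    f ∈ coboundaries₂ (Rep.trivial ℤ G V) ↔
      ∃ u : G → V, ∀ g h, u h - u (g * h) + u g = f (g, h) :=
  ⟨fun ⟨u, hu⟩ ↦ ⟨u, fun g h ↦ congrFun hu (g, h)⟩,
    fun ⟨u, hu⟩ ↦ ⟨u, funext fun x ↦ hu x.1 x.2⟩⟩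

theorem upperTriangularClass_injective (p : ℕ) [NeZero p] :
    Function.Injective (upperTriangularClass p) := by
  rw [injective_iff_map_eq_zero]
  intro t ht
  obtain ⟨u, hu⟩ := mem_coboundaries₂_trivial_iff.1 ((H2π_eq_zero_iff _).1 ht)
  have symm (g h) : upperTriangularCochain t (g, h) = upperTriangularCochain t (h, g) := by
    refine (hu g h).symm.trans (Eq.trans ?_ (hu h g))
    rw [mul_comm g h]
    abel
  have h₁ := symm (.ofAdd (1, 0, 0)) (.ofAdd (0, 1, 0))
  have h₂ := symm (.ofAdd (1, 0, 0)) (.ofAdd (0, 0, 1))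
  have h₃ := symm (.ofAdd (0, 1, 0)) (.ofAdd (0, 0, 1))
  simp [upperTriangularCochain] at h₁ h₂ h₃
  ext <;> assumption

theorem upperTriangularClass_surjective (p : ℕ) [NeZero p] :
    Function.Surjective (upperTriangularClass p) := by
  intro y
  induction y using H2_induction_on with | _ x
  obtain ⟨(f : Multiplicative (ZMod p × ZMod p × ZMod p) ×
    Multiplicative (ZMod p × ZMod p × ZMod p) → UnitAddCircle), hf⟩ := x
  have hf' : ∀ g h j, f (g * h, j) + f (g, h) = f (h, j) + f (g, h * j) :=
    (mem_cocycles₂_iff _).1 hf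
  have torsion (a b : ZMod p × ZMod p × ZMod p) : p • antisymmCocycle hf' a b = 0 := by
    rw [← map_nsmul, show p • b = 0 by ext <;> simp, map_zero]
  obtain ⟨t₁, h₁⟩ := ZMod.exists_toAddCircle_eq (torsion (0, 1, 0) (1, 0, 0))
  obtain ⟨t₂, h₂⟩ := ZMod.exists_toAddCircle_eq (torsion (0, 0, 1) (1, 0, 0))
  obtain ⟨t₃, h₃⟩ := ZMod.exists_toAddCircle_eq (torsion (0, 0, 1) (0, 1, 0))
  refine ⟨(t₁, t₂, t₃), ((H2π_eq_iff _ _).2 (mem_coboundaries₂_trivial_iff.2 ?_)).symm⟩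
  have hd (g h j) : (f - upperTriangularCochain (t₁, t₂, t₃)) (g * h, j) +
      (f - upperTriangularCochain (t₁, t₂, t₃)) (g, h) =
      (f - upperTriangularCochain (t₁, t₂, t₃)) (h, j) +
      (f - upperTriangularCochain (t₁, t₂, t₃)) (g, h * j) := by
    have h₁ := hf' g h j
    have h₂ := upperTriangularCochain_cocycle (t₁, t₂, t₃) g h j
    simp only [Pi.sub_apply]
    grind
  refine exists_coboundary_of_symm hd fun g h ↦ sub_eq_zero.1 ?_
  refine DFunLike.congr_fun (antisymmCocycle_eq_zero hd ?_ ?_ ?_ h.toAdd) g.toAdd <;>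
    simp_all [antisymmCocycle, upperTriangularCochain]

end Rank3

end BilinearCocycles

/-- For a prime `p`, the degree-3 group cohomology of `(ℤ/p)³` with trivial `ℤ`-coefficients
is isomorphic as an abelian group to `(ℤ/p)³`. -/
theorem stmt_2 (p : ℕ) (hp : p.Prime) :
    Nonempty
      ((groupCohomology
          (Rep.trivial ℤ (Multiplicative (ZMod p × ZMod p × ZMod p)) ℤ) 3) ≃+
        (ZMod p × ZMod p × ZMod p)) := by
  have : NeZero p := ⟨hp.ne_zero⟩
  exact ⟨((AddEquiv.ofBijective (upperTriangularClass p)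
    ⟨upperTriangularClass_injective p, upperTriangularClass_surjective p⟩).trans
      (groupCohomology.H2CircleEquivH3Int _)).symm⟩
end

section
/- Let p be a prime. In the polynomial ring ℤ[t], the polynomial t^p − 1 divides ∏_{j=1}^{p−1} (1 − t^j) − (p − ∑_{i=0}^{p−1} t^i); equivalently, ∏_{j=1}^{p−1} (1 − t^j) ≡ p − (1 + t + ⋯ + t^(p−1)) modulo (t^p − 1). -/
open Polynomial in
/-- For a prime `p`, in `ℤ[t]` the polynomial `t^p - 1` divides
`∏_{j=1}^{p-1} (1 - t^j) - (p - ∑_{i=0}^{p-1} t^i)`; i.e.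
`∏_{j=1}^{p-1} (1 - t^j) ≡ p - (1 + t + ⋯ + t^(p-1))` modulo `t^p - 1`. -/
theorem stmt_6 (p : ℕ) (hp : p.Prime) :
    (X ^ p - 1 : ℤ[X]) ∣
      (∏ j ∈ Finset.Icc 1 (p - 1), (1 - X ^ j) -
        ((p : ℤ[X]) - ∑ i ∈ Finset.range p, X ^ i)) := by
  have : Fact p.Prime := ⟨hp⟩
  have hζ := Complex.isPrimitiveRoot_exp p hp.ne_zero
  set ζ := Complex.exp (2 * Real.pi * Complex.I / p)
  have hprod : ∏ j ∈ Finset.Icc 1 (p - 1), (1 - ζ ^ j) = p := by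
    obtain ⟨n, rfl⟩ : ∃ n, p = n + 1 := ⟨p - 1, by have := hp.pos; omega⟩
    have h := hζ.prod_one_sub_pow_eq_order
    rw [Finset.range_eq_Ico, Finset.prod_Ico_add' (fun k => 1 - ζ ^ k) 0 n 1] at h
    simpa [← Finset.Ico_add_one_right_eq_Icc] using h
  -- the difference vanishes at a primitive `p`-th root of unity, so `Φ_p` divides it
  have hdvd : cyclotomic p ℤ ∣ (∏ j ∈ Finset.Icc 1 (p - 1), (1 - X ^ j) -
        ((p : ℤ[X]) - ∑ i ∈ Finset.range p, X ^ i)) := by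
    rw [cyclotomic_eq_minpoly hζ hp.pos]
    refine minpoly.isIntegrallyClosed_dvd (hζ.isIntegral hp.pos) ?_
    simp [map_prod, hprod, hζ.geom_sum_eq_zero hp.one_lt]
  -- it also vanishes at `1`, where `Φ_p` does not
  have hone : (∏ j ∈ Finset.Icc 1 (p - 1), (1 - X ^ j) -
        ((p : ℤ[X]) - ∑ i ∈ Finset.range p, X ^ i)).eval 1 = 0 := by
    have h0 : p - 1 ≠ 0 := by have := hp.two_le; omega
    simp [eval_prod, eval_finsetSum, h0]
  obtain ⟨g, hg⟩ := hdvd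
  rw [hg] at hone ⊢
  rw [eval_mul, eval_one_cyclotomic_prime, mul_eq_zero] at hone
  rw [← cyclotomic_prime_mul_X_sub_one]
  refine mul_dvd_mul_left _ ?_
  rw [← C_1, dvd_iff_isRoot]
  exact hone.resolve_left (by exact_mod_cast hp.ne_zero)
end

section
/- Let p be a prime and ζ ∈ ℂ a primitive p-th root of unity. Define matrices A, B in Matrix (Fin p) (Fin p) ℂ by A := Matrix.diagonal (fun i => ζ^(i : ℕ)) and B i j := if j = i + 1 (addition taken in Fin p, i.e., modulo p) then 1 else 0. Then there is no one-dimensional ℂ-linear subspace L of Fin p → ℂ such that multiplication by A maps L into L and multiplication by B maps L into L. -/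
/-- For a prime `p` and a primitive `p`-th root of unity `ζ ∈ ℂ`, there is no one-dimensional
`ℂ`-linear subspace of `Fin p → ℂ` that is invariant under multiplication by both Heisenberg
matrices `A = diag(1, ζ, …, ζ^(p-1))` and the cyclic permutation matrix `B`. -/
theorem stmt_9 (p : ℕ) (hp : p.Prime) [NeZero p] (ζ : ℂ) (hζ : IsPrimitiveRoot ζ p)
    (A B : Matrix (Fin p) (Fin p) ℂ)
    (hA : A = Matrix.diagonal (fun i : Fin p => ζ ^ (i : ℕ)))
    (hB : B = fun i j => if j = i + 1 then 1 else 0) :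
    ¬ ∃ L : Submodule ℂ (Fin p → ℂ), Module.finrank ℂ L = 1 ∧
        (∀ v ∈ L, A.mulVec v ∈ L) ∧ (∀ v ∈ L, B.mulVec v ∈ L) := by
  subst hA hB
  rintro ⟨L, hL, hLA, hLB⟩
  obtain ⟨⟨v, hv⟩, hv0, hspan⟩ := finrank_eq_one_iff'.mp hL
  have hv0' : v ≠ 0 := fun h => hv0 (Subtype.ext h)
  obtain ⟨a, ha⟩ := hspan ⟨_, hLA v hv⟩
  obtain ⟨b, hb⟩ := hspan ⟨_, hLB v hv⟩
  have ha' (i : Fin p) : a * v i = ζ ^ (i : ℕ) * v i := by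
    simpa [Matrix.mulVec_diagonal] using congrFun (congrArg Subtype.val ha) i
  have hb' (i : Fin p) : b * v i = v (i + 1) := by
    simpa [Matrix.mulVec, dotProduct] using congrFun (congrArg Subtype.val hb) i
  have hb0 : b ≠ 0 := by
    rintro rfl
    refine hv0' (funext fun j => ?_)
    simpa using (hb' (j - 1)).symm
  obtain ⟨i, hi⟩ := Function.ne_iff.mp hv0'
  have hi' : v (i + 1) ≠ 0 := hb' i ▸ mul_ne_zero hb0 hi
  have hpow : ζ ^ ((i + 1 : Fin p) : ℕ) = ζ ^ (i : ℕ) :=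
    (mul_right_cancel₀ hi' (ha' (i + 1))).symm.trans (mul_right_cancel₀ hi (ha' i))
  have hfix : i + 1 = i := Fin.ext (hζ.pow_inj (i + 1).isLt i.isLt hpow)
  have hone : ((1 : Fin p) : ℕ) = 0 := by simp [add_eq_left.mp hfix]
  rw [Fin.val_one', Nat.mod_eq_of_lt hp.one_lt] at hone
  exact one_ne_zero hone
end

section
/- Let p be a prime and ζ ∈ ℂ a primitive p-th root of unity. Define matrices A, B in Matrix (Fin p) (Fin p) ℂ by A := Matrix.diagonal (fun i => ζ^(i : ℕ)) and B i j := if j = i + 1 (addition taken in Fin p, i.e., modulo p) then 1 else 0. Let a, b be natural numbers not both divisible by p. Then the matrix A^a * B^b has p pairwise distinct eigenvalues, and consequently the set of one-dimensional ℂ-linear subspaces L of Fin p → ℂ with Matrix.mulVec (A^a * B^b) mapping L into L has exactly p elements. -/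
/-- If `f` is an endomorphism of an `n`-dimensional space with `n` distinct eigenvalues, then
exactly `n` lines are invariant under `f`. -/
theorem Module.End.ncard_invariant_lines {K V : Type*} [Field K] [AddCommGroup V] [Module K V]
    {n : ℕ} [NeZero n] (hn : Module.finrank K V = n) (f : Module.End K V) (lam : Fin n → K)
    (hinj : Function.Injective lam) (hlam : ∀ i, f.HasEigenvalue (lam i)) :
    {L : Submodule K V | Module.finrank K L = 1 ∧ ∀ v ∈ L, f v ∈ L}.ncard = n := by
  choose e he using fun i => (hlam i).exists_hasEigenvector
  have hli : LinearIndependent K e := Module.End.eigenvectors_linearIndependent' f lam hinj e he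
  let b := basisOfLinearIndependentOfCardEqFinrank hli (by simp [hn])
  have hb : ∀ i, b i = e i := fun i => by simp [b]
  have hfe : ∀ i, f (e i) = lam i • e i := fun i => (he i).apply_eq_smul
  have hset : {L : Submodule K V | Module.finrank K L = 1 ∧ ∀ v ∈ L, f v ∈ L} =
      Set.range fun i => Submodule.span K {e i} := by
    ext L
    constructor
    · rintro ⟨hL, hinv⟩
      obtain ⟨⟨v, hvL⟩, hv0, hv⟩ := finrank_eq_one_iff'.1 hL
      have hspan : L = Submodule.span K {v} := by
        refine le_antisymm (fun w hw => ?_) ((Submodule.span_singleton_le_iff_mem _ _).2 hvL)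
        obtain ⟨c, hc⟩ := hv ⟨w, hw⟩
        exact Submodule.mem_span_singleton.2 ⟨c, congrArg Subtype.val hc⟩
      have hv0' : v ≠ 0 := fun h => hv0 (Subtype.ext h)
      obtain ⟨μ, hμ⟩ := hv ⟨f v, hinv v hvL⟩
      have hμ : μ • v = f v := congrArg Subtype.val hμ
      have hcoord : ∀ j, b.repr v j * lam j = μ * b.repr v j := by
        intro j
        have hf : f v = ∑ i, (b.repr v i * lam i) • b i := by
          conv_lhs => rw [← b.sum_repr v]
          simp [hb, hfe, smul_smul]
        have h := congrArg (fun w => b.repr w j) hμ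
        simp only [hf, b.repr_sum_self, map_smul, Finsupp.smul_apply, smul_eq_mul] at h
        exact h.symm
      obtain ⟨j, hj⟩ : ∃ j, b.repr v j ≠ 0 := by
        by_contra! h
        exact hv0' (b.repr.map_eq_zero_iff.1 (Finsupp.ext h))
      have hμj : μ = lam j := mul_right_cancel₀ hj ((hcoord j).symm.trans (mul_comm _ _))
      have hvj : v = b.repr v j • e j := by
        conv_lhs => rw [← b.sum_repr v]
        rw [Finset.sum_eq_single j _ (by simp), hb]
        intro i _ hij
        have h : b.repr v i * (lam i - lam j) = 0 := by
          rw [mul_sub, hcoord i, hμj]; ring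
        rw [(mul_eq_zero.1 h).resolve_right (sub_ne_zero.2 (hinj.ne hij)), zero_smul]
      refine ⟨j, ?_⟩
      change Submodule.span K {e j} = L
      rw [hspan, hvj, Submodule.span_singleton_smul_eq (IsUnit.mk0 _ hj)]
    · rintro ⟨i, rfl⟩
      refine ⟨finrank_span_singleton (he i).2, fun v hv => ?_⟩
      obtain ⟨c, rfl⟩ := Submodule.mem_span_singleton.1 hv
      rw [map_smul, hfe]
      exact Submodule.smul_mem _ _ (Submodule.smul_mem _ _ (Submodule.mem_span_singleton_self _))
  have hspan_inj : Function.Injective fun i => Submodule.span K {e i} := by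
    intro i j (hij : Submodule.span K {e i} = Submodule.span K {e j})
    obtain ⟨c, hc⟩ := Submodule.mem_span_singleton.1
      (hij ▸ Submodule.mem_span_singleton_self (e i))
    refine hinj (smul_left_injective K (he i).2 ?_)
    change lam i • e i = lam j • e i
    rw [← hfe, ← hc, map_smul, hfe, smul_comm]
  rw [hset, ← Set.image_univ, Set.ncard_image_of_injective _ hspan_inj, Set.ncard_univ,
    Nat.card_fin]

/-- An invertible matrix that commutes with an invertible matrix up to a primitive `n`-th root of
unity has `n` distinct eigenvalues. -/
theorem Matrix.exists_injective_hasEigenvalue_of_mul_eq_smul {K ι : Type*} [Field K]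
    [IsAlgClosed K] [Fintype ι] [DecidableEq ι] [Nonempty ι] {n : ℕ} {M U : Matrix ι ι K}
    (hM : IsUnit M) (hU : IsUnit U) {c : K} (hc : IsPrimitiveRoot c n)
    (hMU : M * U = c • (U * M)) :
    ∃ lam : Fin n → K, Function.Injective lam ∧
      ∀ i, Module.End.HasEigenvalue (Matrix.mulVecLin M) (lam i) := by
  obtain ⟨μ, hμ⟩ := Module.End.exists_eigenvalue (Matrix.mulVecLin M)
  obtain ⟨v, hv⟩ := hμ.exists_hasEigenvector
  have hMv : M.mulVec v = μ • v := hv.apply_eq_smul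
  have hμ0 : μ ≠ 0 := by
    rintro rfl
    refine hv.2 (Matrix.mulVec_injective_iff_isUnit.2 hM ?_)
    rw [hMv, zero_smul, Matrix.mulVec_zero]
  have hpow : ∀ k : ℕ, M * U ^ k = c ^ k • (U ^ k * M) := by
    intro k
    induction k with
    | zero => simp
    | succ k ih =>
      rw [pow_succ, ← mul_assoc, ih, Matrix.smul_mul, mul_assoc, hMU, Matrix.mul_smul, smul_smul,
        mul_assoc, ← pow_succ]
  refine ⟨fun k => c ^ (k : ℕ) * μ, fun i j hij => ?_, fun k => ?_⟩
  · exact Fin.ext (hc.pow_inj i.2 j.2 (mul_right_cancel₀ hμ0 hij))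
  · refine Module.End.hasEigenvalue_of_hasEigenvector (x := (U ^ (k : ℕ)).mulVec v)
      ⟨Module.End.mem_eigenspace_iff.2 ?_, fun h => ?_⟩
    · rw [Matrix.mulVecLin_apply, Matrix.mulVec_mulVec, hpow, Matrix.smul_mulVec,
        ← Matrix.mulVec_mulVec, hMv, Matrix.mulVec_smul, smul_smul]
    · refine hv.2 (Matrix.mulVec_injective_iff_isUnit.2 (hU.pow k) ?_)
      rw [h, Matrix.mulVec_zero]

/-- Powers of elements commuting up to a central scalar. -/
theorem pow_mul_eq_smul_mul_pow {K R : Type*} [CommSemiring K] [Semiring R] [Algebra K R]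
    {x y : R} {c : K} (h : x * y = c • (y * x)) (k : ℕ) : x ^ k * y = c ^ k • (y * x ^ k) := by
  induction k with
  | zero => simp
  | succ k ih =>
    rw [pow_succ, mul_assoc, h, mul_smul_comm, ← mul_assoc, ih, smul_mul_assoc, smul_smul,
      mul_assoc, ← pow_succ']

/-- For a prime `p`, a primitive `p`-th root of unity `ζ ∈ ℂ`, the Heisenberg matrices
`A = diag(1, ζ, …, ζ^(p-1))` and the cyclic permutation matrix `B`, and natural numbers
`a, b` not both divisible by `p`, the matrix `A^a * B^b` has `p` pairwise distinct
eigenvalues, and the set of one-dimensional invariant subspaces of `Fin p → ℂ` for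
multiplication by `A^a * B^b` has exactly `p` elements. -/
theorem stmt_10 (p : ℕ) (hp : p.Prime) [NeZero p] (ζ : ℂ) (hζ : IsPrimitiveRoot ζ p)
    (A B : Matrix (Fin p) (Fin p) ℂ)
    (hA : A = Matrix.diagonal (fun i : Fin p => ζ ^ (i : ℕ)))
    (hB : B = fun i j => if j = i + 1 then 1 else 0)
    (a b : ℕ) (hab : ¬ (p ∣ a ∧ p ∣ b)) :
    (∃ lam : Fin p → ℂ, Function.Injective lam ∧
        ∀ i, Module.End.HasEigenvalue (Matrix.mulVecLin (A ^ a * B ^ b)) (lam i)) ∧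
      {L : Submodule ℂ (Fin p → ℂ) | Module.finrank ℂ L = 1 ∧
          ∀ v ∈ L, (A ^ a * B ^ b).mulVec v ∈ L}.ncard = p := by
  have hζ0 : ζ ≠ 0 := hζ.ne_zero hp.ne_zero
  have hAu : IsUnit A := by
    rw [hA, Matrix.isUnit_diagonal, Pi.isUnit_iff]
    exact fun i => IsUnit.mk0 _ (pow_ne_zero _ hζ0)
  have hBv : ∀ v i, B.mulVec v i = v (i + 1) := by
    intro v i
    simp [hB, Matrix.mulVec, dotProduct]
  have hBu : IsUnit B := by
    refine Matrix.mulVec_injective_iff_isUnit.1 fun v w h => funext fun i => ?_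
    simpa [hBv] using congrFun h (i - 1)
  have hMu : IsUnit (A ^ a * B ^ b) := (hAu.pow a).mul (hBu.pow b)
  have hBA : B * A = ζ • (A * B) := by
    have hsucc : ∀ i : Fin p, ζ ^ ((i + 1 : Fin p) : ℕ) = ζ * ζ ^ (i : ℕ) := by
      intro i
      rw [Fin.val_add, Fin.val_one', Nat.add_mod_mod, ← pow_eq_pow_mod _ hζ.pow_eq_one, pow_succ']
    ext i j
    rw [hA, Matrix.mul_diagonal, Matrix.smul_apply, Matrix.diagonal_mul, hB]
    by_cases h : j = i + 1
    · simp [h, hsucc]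
    · simp [h]
  have hexists : ∃ lam : Fin p → ℂ, Function.Injective lam ∧
      ∀ i, Module.End.HasEigenvalue (Matrix.mulVecLin (A ^ a * B ^ b)) (lam i) := by
    by_cases hb : p ∣ b
    · have ha : ¬ p ∣ a := fun ha => hab ⟨ha, hb⟩
      have hAB : A * B = ζ⁻¹ • (B * A) := by
        rw [hBA, smul_smul, inv_mul_cancel₀ hζ0, one_smul]
      refine Matrix.exists_injective_hasEigenvalue_of_mul_eq_smul hMu hBu
        (hζ.inv.pow_of_coprime a ((hp.coprime_iff_not_dvd.2 ha).symm)) ?_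
      rw [mul_assoc, ← pow_succ, pow_succ', ← mul_assoc, pow_mul_eq_smul_mul_pow hAB,
        smul_mul_assoc, mul_assoc]
    · refine Matrix.exists_injective_hasEigenvalue_of_mul_eq_smul hMu hAu
        (hζ.pow_of_coprime b ((hp.coprime_iff_not_dvd.2 hb).symm)) ?_
      rw [mul_assoc, pow_mul_eq_smul_mul_pow hBA, mul_smul_comm, ← mul_assoc, ← pow_succ,
        pow_succ', mul_assoc]
  obtain ⟨lam, hinj, hlam⟩ := hexists
  have hcard := Module.End.ncard_invariant_lines (by simp) _ lam hinj hlam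
  simp only [Matrix.mulVecLin_apply] at hcard
  exact ⟨⟨lam, hinj, hlam⟩, hcard⟩
end
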